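/- arXiv:1607.08030 — 5 statements merged into one kernel-verified Lean document; each statement's English description precedes it below -/
import Mathlib

section
/- For every piecewise linear function f : [0,1]^m → [0,1] with real coefficients there exists a sequence (g_n) of piecewise linear functions g_n : [0,1]^m → [0,1] with rational coefficients that is pointwise nondecreasing in n (g_n(x) ≤ g_{n+1}(x) ≤ f(x) for all n and x) and converges uniformly to f. -/
open Filter

/-- `f : ℝ^n → ℝ` is a (unital) piecewise linear function on the cube `[0,1]^n`
with coefficients in `S ⊆ ℝ`: it is continuous on the cube, takes values in `[0,1]`
on the cube, and there are finitely many affine functions with coefficients in `S`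
such that at every point of the cube `f` agrees with one of them. -/
def IsPWL {n : ℕ} (S : Set ℝ) (f : (Fin n → ℝ) → ℝ) : Prop :=
  ContinuousOn f (Set.Icc 0 1) ∧
  (∀ x ∈ Set.Icc (0 : Fin n → ℝ) 1, f x ∈ Set.Icc (0 : ℝ) 1) ∧
  ∃ (m : ℕ) (c : Fin m → Fin n → ℝ) (b : Fin m → ℝ),
    (∀ i j, c i j ∈ S) ∧ (∀ i, b i ∈ S) ∧
    ∀ x ∈ Set.Icc (0 : Fin n → ℝ) 1, ∃ i, f x = (∑ j, c i j * x j) + b i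

/-- The affine function with coefficient vector `p.1` and constant term `p.2`, as a continuous
map on the unit cube. -/
noncomputable def affineOnCube {m : ℕ} (p : (Fin m → ℝ) × ℝ) :
    C(Set.Icc (0 : Fin m → ℝ) 1, ℝ) where
  toFun x := (∑ j, p.1 j * x.1 j) + p.2
  continuous_toFun := (continuous_finsetSum _ fun j _ => continuous_const.mul
    ((continuous_apply j).comp continuous_subtype_val)).add continuous_const

/-- The continuous piecewise linear maps on the unit cube with rational coefficients. -/
def rationalPWL (m : ℕ) : Set C(Set.Icc (0 : Fin m → ℝ) 1, ℝ) :=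
  {h | ∃ T : Finset ((Fin m → ℚ) × ℚ), ∀ x, ∃ p ∈ T,
    h x = affineOnCube ((fun j => (p.1 j : ℝ)), (p.2 : ℝ)) x}

theorem affineOnCube_mem_rationalPWL {m : ℕ} (p : (Fin m → ℚ) × ℚ) :
    affineOnCube ((fun j => (p.1 j : ℝ)), (p.2 : ℝ)) ∈ rationalPWL m :=
  ⟨{p}, fun _ => ⟨p, by simp, rfl⟩⟩

theorem zero_mem_rationalPWL (m : ℕ) : 0 ∈ rationalPWL m := by
  convert affineOnCube_mem_rationalPWL (m := m) 0 using 1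
  ext x
  simp [affineOnCube]

theorem sup_mem_rationalPWL {m : ℕ} {h k : C(Set.Icc (0 : Fin m → ℝ) 1, ℝ)}
    (hh : h ∈ rationalPWL m) (hk : k ∈ rationalPWL m) : h ⊔ k ∈ rationalPWL m := by
  classical
  obtain ⟨T, hT⟩ := hh
  obtain ⟨U, hU⟩ := hk
  refine ⟨T ∪ U, fun x => ?_⟩
  rw [ContinuousMap.sup_apply]
  rcases max_choice (h x) (k x) with e | e <;> rw [e]
  · obtain ⟨p, hp, hx⟩ := hT x
    exact ⟨p, Finset.mem_union_left _ hp, hx⟩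
  · obtain ⟨p, hp, hx⟩ := hU x
    exact ⟨p, Finset.mem_union_right _ hp, hx⟩

theorem inf_mem_rationalPWL {m : ℕ} {h k : C(Set.Icc (0 : Fin m → ℝ) 1, ℝ)}
    (hh : h ∈ rationalPWL m) (hk : k ∈ rationalPWL m) : h ⊓ k ∈ rationalPWL m := by
  classical
  obtain ⟨T, hT⟩ := hh
  obtain ⟨U, hU⟩ := hk
  refine ⟨T ∪ U, fun x => ?_⟩
  rw [ContinuousMap.inf_apply]
  rcases min_choice (h x) (k x) with e | e <;> rw [e]
  · obtain ⟨p, hp, hx⟩ := hT x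
    exact ⟨p, Finset.mem_union_left _ hp, hx⟩
  · obtain ⟨p, hp, hx⟩ := hU x
    exact ⟨p, Finset.mem_union_right _ hp, hx⟩

theorem continuous_affineOnCube {m : ℕ} : Continuous (affineOnCube (m := m)) := by
  apply ContinuousMap.continuous_of_continuous_uncurry
  simp only [affineOnCube, Function.uncurry_def, ContinuousMap.coe_mk]
  refine (continuous_finsetSum _ fun j _ => ?_).add (by fun_prop)
  exact (show Continuous _ by fun_prop).mul
    ((continuous_apply j).comp (continuous_subtype_val.comp continuous_snd))

theorem affineOnCube_mem_closure {m : ℕ} (p : (Fin m → ℝ) × ℝ) :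
    affineOnCube p ∈ closure (rationalPWL m) := by
  have hd : DenseRange (Prod.map (Pi.map fun _ : Fin m => ((↑) : ℚ → ℝ)) ((↑) : ℚ → ℝ)) :=
    (DenseRange.piMap fun _ => Rat.denseRange_cast).prodMap Rat.denseRange_cast
  refine map_mem_closure continuous_affineOnCube (hd p) ?_
  rintro _ ⟨q, rfl⟩
  exact affineOnCube_mem_rationalPWL q

instance {X : Type*} [TopologicalSpace X] [LocallyCompactSpace X] : TopologicalLattice C(X, ℝ) where
  continuous_inf := ContinuousMap.continuous_of_continuous_uncurry _ <| by
    simp only [Function.uncurry_def, ContinuousMap.inf_apply]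
    fun_prop
  continuous_sup := ContinuousMap.continuous_of_continuous_uncurry _ <| by
    simp only [Function.uncurry_def, ContinuousMap.sup_apply]
    fun_prop

theorem closure_rationalPWL (m : ℕ) : closure (rationalPWL m) = ⊤ := by
  rw [← closure_closure]
  refine ContinuousMap.sublattice_closure_eq_top _ ⟨_, subset_closure (zero_mem_rationalPWL m)⟩
    (fun h hh k hk => map_mem_closure₂ continuous_inf hh hk fun _ ha _ hb =>
      inf_mem_rationalPWL ha hb)
    (fun h hh k hk => map_mem_closure₂ continuous_sup hh hk fun _ ha _ hb =>
      sup_mem_rationalPWL ha hb) ?_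
  intro v x y
  by_cases hxy : x = y
  · subst hxy
    exact ⟨_, affineOnCube_mem_closure (0, v x), by simp [affineOnCube], by simp [affineOnCube]⟩
  obtain ⟨j, hj⟩ := Function.ne_iff.mp fun h => hxy (Subtype.ext h)
  have hj' : x.1 j - y.1 j ≠ 0 := sub_ne_zero.mpr hj
  set s := (v x - v y) / (x.1 j - y.1 j) with hs
  refine ⟨_, affineOnCube_mem_closure (Pi.single j s, v x - s * x.1 j), ?_, ?_⟩
  · simp [affineOnCube, Pi.single_apply]
  · simp only [affineOnCube, Pi.single_apply, ite_mul, zero_mul, ContinuousMap.coe_mk,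
      Finset.sum_ite_eq', Finset.mem_univ, if_true, hs]
    field_simp
    ring

theorem isPWL_extend {m : ℕ} {h : C(Set.Icc (0 : Fin m → ℝ) 1, ℝ)} (hh : h ∈ rationalPWL m)
    (h01 : ∀ x, h x ∈ Set.Icc (0 : ℝ) 1) :
    IsPWL (Set.range ((↑) : ℚ → ℝ)) (Function.extend Subtype.val h 0) := by
  have he : ∀ x : Set.Icc (0 : Fin m → ℝ) 1, Function.extend Subtype.val h 0 x.1 = h x :=
    Subtype.val_injective.extend_apply _ _
  refine ⟨?_, fun x hx => (he ⟨x, hx⟩).symm ▸ h01 ⟨x, hx⟩, ?_⟩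
  · rw [continuousOn_iff_continuous_domRestrict]
    exact h.continuous.congr fun x => (he x).symm
  · obtain ⟨T, hT⟩ := hh
    refine ⟨T.card, fun i j => ((T.equivFin.symm i).1.1 j : ℝ),
      fun i => ((T.equivFin.symm i).1.2 : ℝ), fun i j => ⟨_, rfl⟩, fun i => ⟨_, rfl⟩,
      fun x hx => ?_⟩
    obtain ⟨p, hp, hpx⟩ := hT ⟨x, hx⟩
    refine ⟨T.equivFin ⟨p, hp⟩, ?_⟩
    rw [he ⟨x, hx⟩, hpx]
    simp [affineOnCube]

theorem exists_rationalPWL_between {m : ℕ} (F : C(Set.Icc (0 : Fin m → ℝ) 1, ℝ)) {ε : ℝ}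
    (hε : 0 < ε) : ∃ h ∈ rationalPWL m, ∀ x, F x - 2 * ε ≤ h x ∧ h x ≤ F x - ε := by
  have hmem : F - ContinuousMap.const _ (3 / 2 * ε) ∈ closure (rationalPWL m) := by
    rw [closure_rationalPWL]; trivial
  obtain ⟨h, hh, hd⟩ := Metric.mem_closure_iff.mp hmem (ε / 2) (by positivity)
  refine ⟨h, hh, fun x => ?_⟩
  have hx := (ContinuousMap.dist_apply_le_dist x).trans_lt hd
  rw [Real.dist_eq, abs_lt] at hx
  simp only [ContinuousMap.sub_apply, ContinuousMap.const_apply] at hx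
  constructor <;> linarith

/-- **Lemma.** Every piecewise linear function `f : [0,1]^m → [0,1]` with real
coefficients is the uniform limit of a pointwise nondecreasing sequence of
piecewise linear functions with rational coefficients lying below `f`. -/
theorem pwl_increasing_rational_approx (m : ℕ) (f : (Fin m → ℝ) → ℝ)
    (hf : IsPWL Set.univ f) :
    ∃ g : ℕ → (Fin m → ℝ) → ℝ,
      (∀ n, IsPWL (Set.range ((↑) : ℚ → ℝ)) (g n)) ∧
      (∀ n, ∀ x ∈ Set.Icc (0 : Fin m → ℝ) 1, g n x ≤ g (n + 1) x) ∧
      (∀ n, ∀ x ∈ Set.Icc (0 : Fin m → ℝ) 1, g n x ≤ f x) ∧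
      TendstoUniformlyOn g f atTop (Set.Icc 0 1) := by
  obtain ⟨hc, h01, -⟩ := hf
  let F : C(Set.Icc (0 : Fin m → ℝ) 1, ℝ) := ⟨_, hc.domRestrict⟩
  have hF : ∀ x (hx : x ∈ Set.Icc (0 : Fin m → ℝ) 1), F ⟨x, hx⟩ = f x := fun _ _ => rfl
  choose h hmem hb using fun n : ℕ =>
    exists_rationalPWL_between F (ε := (1 / 2 : ℝ) ^ n) (by positivity)
  let g : ℕ → (Fin m → ℝ) → ℝ := fun n => Function.extend Subtype.val (h n ⊔ 0 : C(_, ℝ)) 0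
  have hg : ∀ n x (hx : x ∈ Set.Icc (0 : Fin m → ℝ) 1), g n x = max (h n ⟨x, hx⟩) 0 :=
    fun n x hx => Subtype.val_injective.extend_apply _ _ ⟨x, hx⟩
  have hle : ∀ n x, h n x ≤ F x := fun n x =>
    (hb n x).2.trans (sub_le_self _ (by positivity))
  refine ⟨g, fun n => ?_, fun n x hx => ?_, fun n x hx => ?_, ?_⟩
  · refine isPWL_extend (sup_mem_rationalPWL (hmem n) (zero_mem_rationalPWL m)) fun x => ?_
    exact ⟨le_max_right _ _, max_le ((hle n x).trans (h01 x x.2).2) zero_le_one⟩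
  · rw [hg n x hx, hg (n + 1) x hx]
    refine max_le_max_right _ ((hb n _).2.trans (le_trans (le_of_eq ?_) (hb (n + 1) _).1))
    ring
  · rw [hg n x hx]
    exact max_le (hle n _) (h01 x hx).1
  · rw [Metric.tendstoUniformlyOn_iff]
    intro ε hε
    have ht : Tendsto (fun n : ℕ => 2 * (1 / 2 : ℝ) ^ n) atTop (nhds 0) := by
      simpa using (tendsto_pow_atTop_nhds_zero_of_lt_one (r := (1 / 2 : ℝ)) (by norm_num)
        (by norm_num)).const_mul 2
    filter_upwards [ht.eventually_lt_const hε] with n hn x hx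
    have hbx := (hb n ⟨x, hx⟩).1
    have hlx := hle n ⟨x, hx⟩
    rw [hF] at hbx hlx
    rw [hg n x hx, Real.dist_eq, abs_lt]
    have := le_max_left (h n ⟨x, hx⟩) 0
    have := max_le hlx (h01 x hx).1
    constructor <;> linarith
end

section
/- For every piecewise linear function f : [0,1]^m → [0,1] with real coefficients there exists a sequence (h_n) of piecewise linear functions h_n : [0,1]^m → [0,1] with rational coefficients that is pointwise nonincreasing in n (f(x) ≤ h_{n+1}(x) ≤ h_n(x) for all n and x) and converges uniformly to f. -/
open Filter

/-- `g` agrees at every point of the cube with one of finitely many affine functions with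
rational coefficients. -/
def HasRationalPieces {n : ℕ} (g : (Fin n → ℝ) → ℝ) : Prop :=
  ∃ s : Set ((Fin n → ℚ) × ℚ), s.Finite ∧
    ∀ x ∈ Set.Icc (0 : Fin n → ℝ) 1, ∃ p ∈ s, g x = (∑ j, (p.1 j : ℝ) * x j) + p.2

namespace HasRationalPieces

variable {n : ℕ} {g g' k : (Fin n → ℝ) → ℝ}

theorem affine (c : Fin n → ℚ) (b : ℚ) :
    HasRationalPieces fun x : Fin n → ℝ => (∑ j, (c j : ℝ) * x j) + b :=
  ⟨{(c, b)}, Set.finite_singleton _, fun _ _ => ⟨(c, b), rfl, rfl⟩⟩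

theorem const (b : ℚ) : HasRationalPieces fun _ : Fin n → ℝ => (b : ℝ) := by
  simpa using affine (n := n) 0 b

/-- A function that selects pointwise between two functions with rational pieces has rational
pieces. -/
theorem of_eq_or_eq (hg : HasRationalPieces g) (hg' : HasRationalPieces g')
    (hk : ∀ x, k x = g x ∨ k x = g' x) : HasRationalPieces k := by
  obtain ⟨s, hs, hgs⟩ := hg
  obtain ⟨t, ht, hgt⟩ := hg'
  refine ⟨s ∪ t, hs.union ht, fun x hx => ?_⟩
  rcases hk x with h | h
  · obtain ⟨p, hp, hpx⟩ := hgs x hx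
    exact ⟨p, Or.inl hp, h.trans hpx⟩
  · obtain ⟨p, hp, hpx⟩ := hgt x hx
    exact ⟨p, Or.inr hp, h.trans hpx⟩

theorem sup (hg : HasRationalPieces g) (hg' : HasRationalPieces g') :
    HasRationalPieces fun x => g x ⊔ g' x :=
  hg.of_eq_or_eq hg' fun _ => max_choice _ _

theorem inf (hg : HasRationalPieces g) (hg' : HasRationalPieces g') :
    HasRationalPieces fun x => g x ⊓ g' x :=
  hg.of_eq_or_eq hg' fun _ => min_choice _ _

theorem isPWL (hg : HasRationalPieces g) (hc : ContinuousOn g (Set.Icc 0 1))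
    (h01 : ∀ x ∈ Set.Icc (0 : Fin n → ℝ) 1, g x ∈ Set.Icc (0 : ℝ) 1) :
    IsPWL (Set.range ((↑) : ℚ → ℝ)) g := by
  obtain ⟨s, hs, hgs⟩ := hg
  obtain ⟨N, p, -, rfl⟩ := hs.fin_param
  refine ⟨hc, h01, N, fun i j => ((p i).1 j : ℝ), fun i => ((p i).2 : ℝ),
    fun i j => ⟨_, rfl⟩, fun i => ⟨_, rfl⟩, fun x hx => ?_⟩
  obtain ⟨_, ⟨i, rfl⟩, hi⟩ := hgs x hx
  exact ⟨i, hi⟩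

end HasRationalPieces

/-- The restrictions to the cube of continuous functions with rational pieces. -/
def rationalPWLOnCube (n : ℕ) : Set C(Set.Icc (0 : Fin n → ℝ) 1, ℝ) :=
  {φ | ∃ g : C(Fin n → ℝ, ℝ), HasRationalPieces g ∧ g.restrict (Set.Icc 0 1) = φ}

theorem smul_coord_add_const_mem_closure {n : ℕ} (j : Fin n) (α β : ℝ) :
    (⟨fun x => α * (x : Fin n → ℝ) j + β,
      (continuous_const.mul ((continuous_apply j).comp continuous_subtype_val)).add
        continuous_const⟩ : C(Set.Icc (0 : Fin n → ℝ) 1, ℝ)) ∈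
      closure (rationalPWLOnCube n) := by
  let X : C(Set.Icc (0 : Fin n → ℝ) 1, ℝ) := ⟨fun x => (x : Fin n → ℝ) j,
    (continuous_apply j).comp continuous_subtype_val⟩
  have key : α • X + β • (1 : C(Set.Icc (0 : Fin n → ℝ) 1, ℝ)) ∈
      closure (rationalPWLOnCube n) := by
    refine map_mem_closure₂ (f := fun a b : ℝ => a • X + b • 1) (by fun_prop)
      (Rat.denseRange_cast (𝕜 := ℝ) α) (Rat.denseRange_cast (𝕜 := ℝ) β) ?_
    rintro _ ⟨a, rfl⟩ _ ⟨b, rfl⟩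
    refine ⟨⟨fun x => (a : ℝ) * x j + b, by fun_prop⟩, ?_, ?_⟩
    · convert HasRationalPieces.affine (Pi.single j a) b using 2 with x
      simp [Pi.single_apply, apply_ite (Rat.cast : ℚ → ℝ)]
    · ext x
      simp [X]
  convert key using 1
  ext x
  simp [X]

/-- Lattice Stone–Weierstrass for rational piecewise linear functions on the cube. -/
theorem closure_rationalPWLOnCube (n : ℕ) : closure (rationalPWLOnCube n) = Set.univ := by
  have hconst (b : ℝ) : ContinuousMap.const _ b ∈ closure (rationalPWLOnCube n) := by
    refine map_mem_closure ContinuousMap.continuous_const'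
      (Rat.denseRange_cast (𝕜 := ℝ) b) ?_
    rintro _ ⟨q, rfl⟩
    exact ⟨ContinuousMap.const _ (q : ℝ), HasRationalPieces.const q, rfl⟩
  have hlat := ContinuousMap.sublattice_closure_eq_top (closure (rationalPWLOnCube n))
    ⟨_, hconst 0⟩
    (fun φ hφ ψ hψ => map_mem_closure₂ (f := (· ⊓ ·)) ?_ hφ hψ ?_)
    (fun φ hφ ψ hψ => map_mem_closure₂ (f := (· ⊔ ·)) ?_ hφ hψ ?_) ?_
  · simpa using hlat
  · refine ContinuousMap.continuous_of_continuous_uncurry _ ?_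
    simp only [Function.uncurry_def, ContinuousMap.inf_apply]
    fun_prop
  · rintro _ ⟨g, hg, rfl⟩ _ ⟨g', hg', rfl⟩
    exact ⟨g ⊓ g', hg.inf hg', rfl⟩
  · refine ContinuousMap.continuous_of_continuous_uncurry _ ?_
    simp only [Function.uncurry_def, ContinuousMap.sup_apply]
    fun_prop
  · rintro _ ⟨g, hg, rfl⟩ _ ⟨g', hg', rfl⟩
    exact ⟨g ⊔ g', hg.sup hg', rfl⟩
  · intro v x y
    by_cases hxy : x = y
    · subst hxy
      exact ⟨_, hconst (v x), rfl, rfl⟩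
    · obtain ⟨j, hj⟩ := Function.ne_iff.mp (Subtype.coe_ne_coe.mpr hxy)
      have hne : (x : Fin n → ℝ) j - (y : Fin n → ℝ) j ≠ 0 := sub_ne_zero.mpr hj
      refine ⟨_, smul_coord_add_const_mem_closure j ((v x - v y) / (x.1 j - y.1 j))
        (v x - (v x - v y) / (x.1 j - y.1 j) * x.1 j), ?_, ?_⟩
      · simp
      · simp only [ContinuousMap.coe_mk]
        field_simp
        ring

/-- Continuous functions on the cube are uniform limits of rational piecewise linear functions. -/
theorem exists_hasRationalPieces_abs_sub_lt {n : ℕ} {f : (Fin n → ℝ) → ℝ}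
    (hf : ContinuousOn f (Set.Icc 0 1)) {ε : ℝ} (hε : 0 < ε) :
    ∃ g : (Fin n → ℝ) → ℝ, Continuous g ∧ HasRationalPieces g ∧
      ∀ x ∈ Set.Icc (0 : Fin n → ℝ) 1, |g x - f x| < ε := by
  let F : C(Set.Icc (0 : Fin n → ℝ) 1, ℝ) := ⟨_, hf.domRestrict⟩
  have hF : F ∈ closure (rationalPWLOnCube n) := by simp [closure_rationalPWLOnCube]
  obtain ⟨_, ⟨g, hg, rfl⟩, hd⟩ := Metric.mem_closure_iff.mp hF ε hε
  refine ⟨g, g.continuous, hg, fun x hx => ?_⟩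
  rw [dist_comm] at hd
  exact (ContinuousMap.dist_apply_le_dist (⟨x, hx⟩ : Set.Icc (0 : Fin n → ℝ) 1)).trans_lt hd

/-- **Lemma.** Every piecewise linear function `f : [0,1]^m → [0,1]` with real
coefficients is the uniform limit of a pointwise nonincreasing sequence of
piecewise linear functions with rational coefficients lying above `f`. -/
theorem pwl_decreasing_rational_approx (m : ℕ) (f : (Fin m → ℝ) → ℝ)
    (hf : IsPWL Set.univ f) :
    ∃ h : ℕ → (Fin m → ℝ) → ℝ,
      (∀ n, IsPWL (Set.range ((↑) : ℚ → ℝ)) (h n)) ∧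
      (∀ n, ∀ x ∈ Set.Icc (0 : Fin m → ℝ) 1, h (n + 1) x ≤ h n x) ∧
      (∀ n, ∀ x ∈ Set.Icc (0 : Fin m → ℝ) 1, f x ≤ h n x) ∧
      TendstoUniformlyOn h f atTop (Set.Icc 0 1) := by
  obtain ⟨hfc, hf01, -⟩ := hf
  have hε (n : ℕ) : (0 : ℝ) < (1 / 2) ^ n := by positivity
  have happrox (n : ℕ) := exists_hasRationalPieces_abs_sub_lt
    (hfc.add (continuousOn_const (c := (1 / 2 : ℝ) ^ n))) (ε := (1 / 2) ^ n / 8)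
    (by have := hε n; linarith)
  choose g hgc hgp hg using happrox
  simp only [Pi.add_apply] at hg
  have hlow : ∀ n, ∀ x ∈ Set.Icc (0 : Fin m → ℝ) 1, f x + 7 / 8 * (1 / 2) ^ n ≤ g n x := by
    intro n x hx
    linarith [(abs_lt.mp (hg n x hx)).1]
  have hupp : ∀ n, ∀ x ∈ Set.Icc (0 : Fin m → ℝ) 1, g n x ≤ f x + 9 / 8 * (1 / 2) ^ n := by
    intro n x hx
    linarith [(abs_lt.mp (hg n x hx)).2]
  have hfh : ∀ n, ∀ x ∈ Set.Icc (0 : Fin m → ℝ) 1, f x ≤ g n x ⊓ 1 := fun n x hx =>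
    le_inf (by linarith [hlow n x hx, hε n]) (hf01 x hx).2
  refine ⟨fun n x => g n x ⊓ 1, fun n => ?_, fun n x hx => ?_, hfh, ?_⟩
  · refine HasRationalPieces.isPWL ?_ ((hgc n).inf continuous_const).continuousOn
      fun x hx => ⟨(hf01 x hx).1.trans (hfh n x hx), inf_le_right⟩
    simpa using (hgp n).inf (HasRationalPieces.const 1)
  · refine inf_le_inf_right _ ?_
    have h1 := hupp (n + 1) x hx
    rw [pow_succ] at h1
    linarith [hlow n x hx, hε n]
  · rw [Metric.tendstoUniformlyOn_iff]
    intro ε hpos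
    have hlim : Tendsto (fun n : ℕ => 9 / 8 * (1 / 2 : ℝ) ^ n) atTop (nhds 0) := by
      simpa using (tendsto_pow_atTop_nhds_zero_of_lt_one (r := (1 / 2 : ℝ))
        (by norm_num) (by norm_num)).const_mul (9 / 8)
    filter_upwards [hlim.eventually_lt_const hpos] with n hn x hx
    rw [dist_comm, Real.dist_eq, abs_of_nonneg (sub_nonneg.mpr (hfh n x hx))]
    linarith [hupp n x hx, inf_le_left (a := g n x) (b := 1)]
end

section
/- For every natural number n, the closure, with respect to the sup metric on continuous real-valued functions on [0,1]^n, of the set of piecewise linear functions [0,1]^n → [0,1] with real coefficients equals the set of all continuous functions [0,1]^n → ℝ taking values in [0,1]. (Equivalently: the completion of the space of piecewise linear functions with real coefficients under the sup norm is C([0,1]^n) restricted to [0,1]-valued functions.) -/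
/-- The cube `[0,1]^n` as a compact topological space. -/
abbrev UnitCube (n : ℕ) : Type := Fin n → Set.Icc (0 : ℝ) 1

/-- A continuous map `F : [0,1]^n → ℝ` is a (unital) piecewise linear function with
real coefficients: it takes values in `[0,1]` and there are finitely many affine
functions (with real coefficients) such that at every point `F` agrees with one of
them. -/
def IsPWLReal {n : ℕ} (F : C(UnitCube n, ℝ)) : Prop :=
  (∀ x, F x ∈ Set.Icc (0 : ℝ) 1) ∧
  ∃ (m : ℕ) (c : Fin m → Fin n → ℝ) (b : Fin m → ℝ),
    ∀ x : UnitCube n, ∃ i, F x = (∑ j, c i j * (x j : ℝ)) + b i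

/-- `F` agrees at every point of the cube with one of finitely many affine functions, encoded by
their linear coefficients and constant term. No bound on the values of `F` is imposed. -/
def IsPiecewiseAffine {n : ℕ} (F : C(UnitCube n, ℝ)) : Prop :=
  ∃ S : Set ((Fin n → ℝ) × ℝ), S.Finite ∧
    ∀ x : UnitCube n, ∃ p ∈ S, F x = (∑ j, p.1 j * (x j : ℝ)) + p.2

namespace IsPiecewiseAffine

variable {n : ℕ} {F G : C(UnitCube n, ℝ)}

/-- A continuous selection from two piecewise affine functions is piecewise affine. -/
theorem of_eq_or_eq {H : C(UnitCube n, ℝ)} (hF : IsPiecewiseAffine F)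
    (hG : IsPiecewiseAffine G) (hH : ∀ x, H x = F x ∨ H x = G x) : IsPiecewiseAffine H := by
  obtain ⟨S, hS, hFS⟩ := hF
  obtain ⟨T, hT, hGT⟩ := hG
  refine ⟨S ∪ T, hS.union hT, fun x => ?_⟩
  rcases hH x with h | h
  · obtain ⟨p, hp, hx⟩ := hFS x
    exact ⟨p, Or.inl hp, h.trans hx⟩
  · obtain ⟨p, hp, hx⟩ := hGT x
    exact ⟨p, Or.inr hp, h.trans hx⟩

theorem inf (hF : IsPiecewiseAffine F) (hG : IsPiecewiseAffine G) :
    IsPiecewiseAffine (F ⊓ G) :=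
  hF.of_eq_or_eq hG fun x => min_choice (F x) (G x)

theorem sup (hF : IsPiecewiseAffine F) (hG : IsPiecewiseAffine G) :
    IsPiecewiseAffine (F ⊔ G) :=
  hF.of_eq_or_eq hG fun x => max_choice (F x) (G x)

theorem of_affine (c : Fin n → ℝ) (b : ℝ) (hF : ∀ x, F x = (∑ j, c j * (x j : ℝ)) + b) :
    IsPiecewiseAffine F :=
  ⟨{(c, b)}, Set.finite_singleton _, fun x => ⟨(c, b), rfl, hF x⟩⟩

theorem const (n : ℕ) (r : ℝ) : IsPiecewiseAffine (ContinuousMap.const (UnitCube n) r) :=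
  of_affine 0 r fun x => by simp

theorem isPWLReal (hF : IsPiecewiseAffine F) (h : ∀ x, F x ∈ Set.Icc (0 : ℝ) 1) :
    IsPWLReal F := by
  obtain ⟨S, hS, hFS⟩ := hF
  have := hS.to_subtype
  obtain ⟨m, ⟨e⟩⟩ := Finite.exists_equiv_fin S
  refine ⟨h, m, fun i => (e.symm i).1.1, fun i => (e.symm i).1.2, fun x => ?_⟩
  obtain ⟨p, hp, hx⟩ := hFS x
  exact ⟨e ⟨p, hp⟩, by simpa using hx⟩

theorem separatesPointsStrongly (n : ℕ) :
    Set.SeparatesPointsStrongly {F : C(UnitCube n, ℝ) | IsPiecewiseAffine F} := by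
  intro v x y
  by_cases hxy : x = y
  · subst hxy
    exact ⟨_, const n (v x), rfl, rfl⟩
  · obtain ⟨j, hj⟩ := Function.ne_iff.mp hxy
    have hj' : (y j : ℝ) - x j ≠ 0 := sub_ne_zero.mpr fun h => hj (Subtype.ext h.symm)
    let a : ℝ := (v y - v x) / (y j - x j)
    let F : C(UnitCube n, ℝ) := ⟨fun z => a * (z j : ℝ) + (v x - a * x j), by fun_prop⟩
    refine ⟨F, of_affine (Pi.single j a) (v x - a * x j) fun z => ?_, ?_, ?_⟩
    · simp [F, Pi.single_apply]
    · simp [F]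
    · simp only [F, a, ContinuousMap.coe_mk]
      field_simp
      ring

theorem closure_eq_top (n : ℕ) :
    closure {F : C(UnitCube n, ℝ) | IsPiecewiseAffine F} = ⊤ :=
  ContinuousMap.sublattice_closure_eq_top _ ⟨_, const n 0⟩ (fun _ hF _ hG => hF.inf hG)
    (fun _ hF _ hG => hF.sup hG) (separatesPointsStrongly n)

end IsPiecewiseAffine

/-- **Theorem.** The closure, in the sup metric on `C([0,1]^n, ℝ)`, of the set of
piecewise linear functions with real coefficients is exactly the set of all
continuous `[0,1]`-valued functions; i.e. the norm-completion of `RL_n` with respect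
to the unit norm is `C([0,1]^n)` (restricted to `[0,1]`-valued functions). -/
theorem closure_pwl_eq_unitValued_continuous (n : ℕ) :
    closure {F : C(UnitCube n, ℝ) | IsPWLReal F} =
      {F : C(UnitCube n, ℝ) | ∀ x, F x ∈ Set.Icc (0 : ℝ) 1} := by
  apply subset_antisymm
  · refine closure_minimal (fun F hF => hF.1) ?_
    simp only [Set.ofPred_forall]
    exact isClosed_iInter fun x => isClosed_Icc.preimage (continuous_eval_const x)
  · intro F hF
    let clamp : C(UnitCube n, ℝ) → C(UnitCube n, ℝ) := fun G =>
      (G ⊔ ContinuousMap.const _ 0) ⊓ ContinuousMap.const _ 1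
    have hclamp : Continuous clamp :=
      ContinuousMap.continuous_postcomp (⟨fun t => (t ⊔ 0) ⊓ 1, by fun_prop⟩ : C(ℝ, ℝ))
    have hF' : clamp F = F := by
      ext x
      simp [clamp, (hF x).1, (hF x).2]
    have hmem : F ∈ closure {G : C(UnitCube n, ℝ) | IsPiecewiseAffine G} := by
      rw [IsPiecewiseAffine.closure_eq_top]
      trivial
    rw [← hF']
    refine map_mem_closure hclamp hmem fun G hG => ?_
    refine IsPiecewiseAffine.isPWLReal
      ((IsPiecewiseAffine.sup hG (.const n 0)).inf (.const n 1)) fun x => ?_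
    simp [clamp]
end

section
/- There exists a piecewise linear function f : [0,1] → [0,1] with real coefficients such that for every piecewise linear function g : [0,1] → [0,1] with integer coefficients, g⁻¹({0}) ≠ f⁻¹({0}). (Consequently, there exists a principal ideal in the free Riesz MV-algebra RMV_1 that is not generated by an element of the free MV-algebra MV_1.) -/
/-- `f : ℝ → ℝ` is a (unital) piecewise linear function on `[0,1]` with
coefficients in `S ⊆ ℝ`. -/
def IsPWL1 (S : Set ℝ) (f : ℝ → ℝ) : Prop :=
  ContinuousOn f (Set.Icc 0 1) ∧
  (∀ x ∈ Set.Icc (0 : ℝ) 1, f x ∈ Set.Icc (0 : ℝ) 1) ∧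
  ∃ (m : ℕ) (c b : Fin m → ℝ),
    (∀ i, c i ∈ S) ∧ (∀ i, b i ∈ S) ∧
    ∀ x ∈ Set.Icc (0 : ℝ) 1, ∃ i, f x = c i * x + b i

open Filter Topology in
/-- A piecewise linear function with integer coefficients that vanishes at an irrational
interior point vanishes in a neighbourhood of that point. -/
theorem IsPWL1.eventually_eq_zero_of_irrational {g : ℝ → ℝ}
    (hg : IsPWL1 (Set.range ((↑) : ℤ → ℝ)) g) {a : ℝ} (ha : Irrational a)
    (ha01 : a ∈ Set.Ioo (0 : ℝ) 1) (hga : g a = 0) : ∀ᶠ x in 𝓝 a, g x = 0 := by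
  obtain ⟨hcont, -, m, c, b, hc, hb, hpieces⟩ := hg
  have hnhds : Set.Icc (0 : ℝ) 1 ∈ 𝓝 a := Icc_mem_nhds ha01.1 ha01.2
  have hga_cont : ContinuousAt g a := hcont.continuousAt hnhds
  have hne : ∀ᶠ x in 𝓝 a, ∀ i, c i * a + b i ≠ 0 → g x ≠ c i * x + b i := by
    refine eventually_all.2 fun i => ?_
    by_cases h : c i * a + b i = 0
    · simp [h]
    · have hcont' : ContinuousAt (fun x => g x - (c i * x + b i)) a := by fun_prop
      have hval : g a - (c i * a + b i) ≠ 0 := by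
        rw [hga, zero_sub]
        exact neg_ne_zero.2 h
      filter_upwards [hcont'.eventually_ne hval] with x hx _
      exact sub_ne_zero.1 hx
  filter_upwards [hne, hnhds] with x hx hx01
  obtain ⟨i, hi⟩ := hpieces x hx01
  have hroot : c i * a + b i = 0 := by_contra fun h => hx i h hi
  obtain ⟨p, hp⟩ := hc i
  obtain ⟨q, hq⟩ := hb i
  rw [← hp, ← hq] at hroot hi
  have hp0 : p = 0 := by
    by_contra h
    refine (ha.intCast_mul h).ne_int (-q) ?_
    push_cast
    linarith
  simp only [hp0, Int.cast_zero, zero_mul, zero_add] at hroot hi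
  rw [hi, hroot]

/-- The distance to a point of `[0,1]` is piecewise linear on `[0,1]`. -/
theorem isPWL1_abs_sub {a : ℝ} (ha : a ∈ Set.Icc (0 : ℝ) 1) :
    IsPWL1 Set.univ fun x => |x - a| := by
  refine ⟨by fun_prop, fun x hx => ⟨abs_nonneg _, abs_le.2 ⟨?_, ?_⟩⟩,
    2, ![1, -1], ![-a, a], fun _ => trivial, fun _ => trivial, fun x _ => ?_⟩
  · linarith [hx.1, ha.2]
  · linarith [hx.2, ha.1]
  · rcases abs_choice (x - a) with h | h
    · exact ⟨0, h.trans (by simp [sub_eq_add_neg])⟩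
    · exact ⟨1, h.trans (by simp [sub_eq_add_neg, add_comm])⟩

/-- **Proposition.** There is a piecewise linear function `f : [0,1] → [0,1]` with
real coefficients whose zero set differs from the zero set of every piecewise linear
function with integer coefficients. (Hence some principal ideal of the free Riesz
MV-algebra `RMV₁` is not generated by an element of the free MV-algebra `MV₁`.) -/
theorem exists_pwl_real_zeroset_not_integer :
    ∃ f : ℝ → ℝ, IsPWL1 Set.univ f ∧
      ∀ g : ℝ → ℝ, IsPWL1 (Set.range ((↑) : ℤ → ℝ)) g →
        {x ∈ Set.Icc (0 : ℝ) 1 | g x = 0} ≠ {x ∈ Set.Icc (0 : ℝ) 1 | f x = 0} := by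
  obtain ⟨a, ha, ha0, ha1⟩ := exists_irrational_btwn (zero_lt_one (α := ℝ))
  refine ⟨fun x => |x - a|, isPWL1_abs_sub ⟨ha0.le, ha1.le⟩, fun g hg hzero => ?_⟩
  have hga : a ∈ {x ∈ Set.Icc (0 : ℝ) 1 | g x = 0} := by
    rw [hzero]
    exact ⟨⟨ha0.le, ha1.le⟩, by simp⟩
  have hev : ∀ᶠ x in nhds a, x = a := by
    filter_upwards [hg.eventually_eq_zero_of_irrational ha ⟨ha0, ha1⟩ hga.2,
      Icc_mem_nhds ha0 ha1] with x hx hx01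
    have hxa : x ∈ {x ∈ Set.Icc (0 : ℝ) 1 | |x - a| = 0} := hzero ▸ ⟨hx01, hx⟩
    exact sub_eq_zero.1 (abs_eq_zero.1 hxa.2)
  obtain ⟨x, hx, hxa⟩ :=
    ((hev.filter_mono nhdsWithin_le_nhds).and (self_mem_nhdsWithin (s := {a}ᶜ))).exists
  exact hxa hx
end

section
/- For every piecewise linear function f : [0,1]^n → [0,1] with rational coefficients there exist a piecewise linear function b : [0,1]^n → [0,1] with integer coefficients and a natural number m such that f(x) ≤ b(x) and b(x) ≤ min(1, m·f(x)) for all x ∈ [0,1]^n. (This expresses that every principal ideal of the free DMV-algebra DMV_n can be generated by an element of the free MV-algebra MV_n, i.e., is MV-generated.) -/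
/-- Finitely many rational numbers have a common positive denominator. -/
theorem exists_common_denominator {ι : Type*} [Fintype ι] (r : ι → ℝ)
    (hr : ∀ i, r i ∈ Set.range ((↑) : ℚ → ℝ)) :
    ∃ d : ℕ, 0 < d ∧ ∀ i, (d : ℝ) * r i ∈ Set.range ((↑) : ℤ → ℝ) := by
  choose q hq using hr
  refine ⟨∏ i, (q i).den, Finset.prod_pos fun i _ => (q i).den_pos, fun i => ?_⟩
  obtain ⟨k, hk⟩ := Finset.dvd_prod_of_mem (fun i => (q i).den) (Finset.mem_univ i)
  refine ⟨k * (q i).num, ?_⟩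
  have h : ((q i).den : ℝ) * (q i : ℝ) = (q i).num := by
    exact_mod_cast Rat.den_mul_eq_num (q i)
  rw [hk, ← hq i]
  push_cast
  rw [← h]
  ring

/-- A suitable positive multiple of a rational piecewise linear function, truncated at `1`,
is piecewise linear with integer coefficients. -/
theorem IsPWL.exists_truncated_multiple {n : ℕ} {f : (Fin n → ℝ) → ℝ}
    (hf : IsPWL (Set.range ((↑) : ℚ → ℝ)) f) :
    ∃ d : ℕ, 0 < d ∧
      IsPWL (Set.range ((↑) : ℤ → ℝ)) fun x => min 1 ((d : ℝ) * f x) := by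
  obtain ⟨hcont, hmem, k, c, b, hc, hb, hval⟩ := hf
  obtain ⟨d, hd, hint⟩ := exists_common_denominator
    (Sum.elim (fun p : Fin k × Fin n => c p.1 p.2) b)
    (by rintro (p | i) <;> simp only [Sum.elim_inl, Sum.elim_inr, hc, hb])
  refine ⟨d, hd, continuousOn_const.inf (continuousOn_const.mul hcont),
    fun x hx => ⟨le_min zero_le_one (mul_nonneg d.cast_nonneg (hmem x hx).1), min_le_left _ _⟩,
    k + 1, Fin.cons 0 fun i j => d * c i j, Fin.cons 1 fun i => d * b i, ?_, ?_, ?_⟩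
  · refine Fin.cases (fun j => ⟨0, by simp⟩) fun i j => ?_
    simpa using hint (Sum.inl (i, j))
  · refine Fin.cases ⟨1, by simp⟩ fun i => ?_
    simpa using hint (Sum.inr i)
  · intro x hx
    rcases le_total 1 ((d : ℝ) * f x) with h | h
    · exact ⟨0, by simp [h]⟩
    · obtain ⟨i, hi⟩ := hval x hx
      refine ⟨i.succ, ?_⟩
      dsimp only
      rw [min_eq_right h, hi]
      simp only [Fin.cons_succ, mul_add, Finset.mul_sum, mul_assoc]

/-- **Remark (principal ideals of `DMV_n` are MV-generated).** For every piecewise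
linear `f : [0,1]^n → [0,1]` with rational coefficients there are a piecewise linear
`b` with integer coefficients and `m : ℕ` with `f ≤ b` and `b ≤ min 1 (m·f)`
pointwise on the cube. -/
theorem rational_pwl_ideal_mv_generated (n : ℕ) (f : (Fin n → ℝ) → ℝ)
    (hf : IsPWL (Set.range ((↑) : ℚ → ℝ)) f) :
    ∃ (b : (Fin n → ℝ) → ℝ) (m : ℕ),
      IsPWL (Set.range ((↑) : ℤ → ℝ)) b ∧
      (∀ x ∈ Set.Icc (0 : Fin n → ℝ) 1, f x ≤ b x) ∧
      (∀ x ∈ Set.Icc (0 : Fin n → ℝ) 1, b x ≤ min 1 ((m : ℝ) * f x)) := by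
  obtain ⟨d, hd, hb⟩ := hf.exists_truncated_multiple
  refine ⟨_, d, hb, fun x hx => ?_, fun x _ => le_rfl⟩
  obtain ⟨h0, h1⟩ := hf.2.1 x hx
  exact le_min h1 (le_mul_of_one_le_left h0 (by exact_mod_cast hd))
end
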